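/- The three-node GCM graph with node set {1,2,3}, M_{12} = −1, M_{21} = −3, M_{23} = M_{32} = −1, and M_{13} = M_{31} = 0 (a path whose first edge has amplitude product 3 and whose second edge has amplitude product 1) is not admissible: there is no nonzero dominant position on it from which some game sequence converges. -/

import Mathlib

/-- Firing node `i` transforms the position `lam` by `lam j ↦ lam j - M i j * lam i`. -/
def fire (M : ℕ → ℕ → ℤ) (lam : ℕ → ℝ) (i : ℕ) : ℕ → ℝ :=
  fun j => lam j - (M i j : ℝ) * lam i

/-- The position obtained from `lam` by firing the nodes of a list in order. -/
def fireList (M : ℕ → ℕ → ℤ) : (ℕ → ℝ) → List ℕ → (ℕ → ℝ)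
  | lam, [] => lam
  | lam, i :: s => fireList M (fire M lam i) s

/-- A list of node firings is legal from `lam` (on the graph with node set `{1,…,n}`)
if each fired node is a node of the graph carrying a positive number at the time of firing. -/
def LegalSeq (n : ℕ) (M : ℕ → ℕ → ℤ) : (ℕ → ℝ) → List ℕ → Prop
  | _, [] => True
  | lam, i :: s => 1 ≤ i ∧ i ≤ n ∧ 0 < lam i ∧ LegalSeq n M (fire M lam i) s

/-- A convergent game sequence from `lam` on the graph with node set `{1,…,n}`:
a legal firing sequence after which no node has a positive number. -/
def ConvSeq (n : ℕ) (M : ℕ → ℕ → ℤ) (lam : ℕ → ℝ) (s : List ℕ) : Prop :=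
  LegalSeq n M lam s ∧ ∀ i, 1 ≤ i → i ≤ n → fireList M lam s i ≤ 0

/-- The sequence of positions along an infinite firing sequence `f`. -/
def posSeq (M : ℕ → ℕ → ℤ) (lam : ℕ → ℝ) (f : ℕ → ℕ) : ℕ → (ℕ → ℝ)
  | 0 => lam
  | k + 1 => fire M (posSeq M lam f k) (f k)

/-- A divergent game sequence from `lam` on the graph with node set `{1,…,n}`:
an infinite sequence of legal firings of nodes of the graph. -/
def DivergentSeq (n : ℕ) (M : ℕ → ℕ → ℤ) (lam : ℕ → ℝ) (f : ℕ → ℕ) : Prop :=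
  ∀ k, 1 ≤ f k ∧ f k ≤ n ∧ 0 < posSeq M lam f k (f k)

/-- A GCM graph with node set `{1,…,n}` is admissible if there is a nonzero dominant
position from which some game sequence converges. -/
def Admissible (n : ℕ) (M : ℕ → ℕ → ℤ) : Prop :=
  ∃ lam : ℕ → ℝ, (∀ i, 1 ≤ i → i ≤ n → 0 ≤ lam i) ∧
    (∃ i, 1 ≤ i ∧ i ≤ n ∧ lam i ≠ 0) ∧ ∃ s : List ℕ, ConvSeq n M lam s

/-- The three-node GCM graph with `M 1 2 = -1`, `M 2 1 = -3`, `M 2 3 = M 3 2 = -1`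
and `M 1 3 = M 3 1 = 0`: a path whose first edge has amplitude product `3` and whose
second edge has amplitude product `1`. -/
def Mpath31 : ℕ → ℕ → ℤ := fun i j =>
  if i = j then 2
  else if (i, j) = (1, 2) then -1
  else if (i, j) = (2, 1) then -3
  else if (i, j) = (2, 3) ∨ (i, j) = (3, 2) then -1
  else 0

/-- Firing a node of the graph preserves `lam 1 + 2 * lam 2 + lam 3`, since `(1, 2, 1)` lies in the
right kernel of the matrix. -/
lemma fire_Mpath31_invariant (lam : ℕ → ℝ) {i : ℕ} (h1 : 1 ≤ i) (h3 : i ≤ 3) :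
    fire Mpath31 lam i 1 + 2 * fire Mpath31 lam i 2 + fire Mpath31 lam i 3 =
      lam 1 + 2 * lam 2 + lam 3 := by
  interval_cases i <;> norm_num [fire, Mpath31] <;> ring

lemma fireList_Mpath31_invariant (s : List ℕ) (lam : ℕ → ℝ) (h : LegalSeq 3 Mpath31 lam s) :
    fireList Mpath31 lam s 1 + 2 * fireList Mpath31 lam s 2 + fireList Mpath31 lam s 3 =
      lam 1 + 2 * lam 2 + lam 3 := by
  induction s generalizing lam with
  | nil => rfl
  | cons i s ih =>
    obtain ⟨h1, h3, -, hs⟩ := h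
    exact (ih _ hs).trans (fire_Mpath31_invariant lam h1 h3)

/-- The three-node path GCM graph with amplitude products `3` and `1` on its edges is
not admissible. -/
theorem path31_not_admissible : ¬ Admissible 3 Mpath31 := by
  rintro ⟨lam, hdom, ⟨i, hi1, hi3, hne⟩, s, hlegal, hend⟩
  have hinv := fireList_Mpath31_invariant s lam hlegal
  have d1 := hdom 1 (by norm_num) (by norm_num)
  have d2 := hdom 2 (by norm_num) (by norm_num)
  have d3 := hdom 3 (by norm_num) (by norm_num)
  have e1 := hend 1 (by norm_num) (by norm_num)
  have e2 := hend 2 (by norm_num) (by norm_num)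
  have e3 := hend 3 (by norm_num) (by norm_num)
  apply hne
  interval_cases i <;> linarith
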